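/- Let g be smooth on Ω, let R = [a₁,a₂] × [b₁,b₂] be a closed rectangle contained in Ω, and let z ∈ C³(Ω) be a solution of Darboux's equation on Ω. Define h₁ := (det g)^{−1/2}(∂₁z·∇₂₂z − ∂₂z·∇₁₂z) and h₂ := (det g)^{−1/2}(∂₂z·∇₁₁z − ∂₁z·∇₁₂z). Then ∬_R K·(2 − 3|∇_g z|²)·√(det g) dx dy = ∫_{b₁}^{b₂} [h₁(a₂,y) − h₁(a₁,y)] dy + ∫_{a₁}^{a₂} [h₂(x,b₂) − h₂(x,b₁)] dx, where K is the Gaussian curvature of g. -/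

import Mathlib

open Real Set Filter Topology

noncomputable section

/-- Partial derivative of `f : ℝ × ℝ → ℝ` in coordinate direction `i`. -/
def pd (i : Fin 2) (f : ℝ × ℝ → ℝ) (p : ℝ × ℝ) : ℝ :=
  fderiv ℝ f p (if i = 0 then (1, 0) else (0, 1))

/-- The metric components as a 2×2 symmetric matrix of functions. -/
def gmat (g11 g12 g22 : ℝ × ℝ → ℝ) (i j : Fin 2) : ℝ × ℝ → ℝ :=
  if i = 0 then (if j = 0 then g11 else g12) else (if j = 0 then g12 else g22)

/-- The determinant of the metric. -/
def gdet (g11 g12 g22 : ℝ × ℝ → ℝ) (p : ℝ × ℝ) : ℝ :=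
  g11 p * g22 p - g12 p ^ 2

/-- Components of the inverse metric. -/
def ginv (g11 g12 g22 : ℝ × ℝ → ℝ) (i j : Fin 2) (p : ℝ × ℝ) : ℝ :=
  (if i = 0 then (if j = 0 then g22 p else -g12 p)
   else (if j = 0 then -g12 p else g11 p)) / gdet g11 g12 g22 p

/-- Christoffel symbols Γˡ_{ij}. -/
def Chr (g11 g12 g22 : ℝ × ℝ → ℝ) (l i j : Fin 2) (p : ℝ × ℝ) : ℝ :=
  (1 / 2) * ∑ m : Fin 2, ginv g11 g12 g22 l m p *
    (pd i (gmat g11 g12 g22 j m) p + pd j (gmat g11 g12 g22 i m) p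
      - pd m (gmat g11 g12 g22 i j) p)

/-- Second covariant derivatives ∇_{ij} z. -/
def cov2 (g11 g12 g22 z : ℝ × ℝ → ℝ) (i j : Fin 2) (p : ℝ × ℝ) : ℝ :=
  pd i (pd j z) p - ∑ l : Fin 2, Chr g11 g12 g22 l i j p * pd l z p

/-- |∇_g z|². -/
def gradSq (g11 g12 g22 z : ℝ × ℝ → ℝ) (p : ℝ × ℝ) : ℝ :=
  ∑ i : Fin 2, ∑ j : Fin 2, ginv g11 g12 g22 i j p * pd i z p * pd j z p

/-- The Gaussian curvature of the metric g. -/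
def GaussK (g11 g12 g22 : ℝ × ℝ → ℝ) (p : ℝ × ℝ) : ℝ :=
  (1 / gdet g11 g12 g22 p) * ∑ i : Fin 2, gmat g11 g12 g22 0 i p *
    (pd 0 (Chr g11 g12 g22 i 1 1) p - pd 1 (Chr g11 g12 g22 i 0 1) p
      + ∑ j : Fin 2, (Chr g11 g12 g22 j 1 1 p * Chr g11 g12 g22 i j 0 p
          - Chr g11 g12 g22 j 0 1 p * Chr g11 g12 g22 i j 1 p))

/-- Darboux's equation at a point p. -/
def DarbouxEq (g11 g12 g22 z : ℝ × ℝ → ℝ) (p : ℝ × ℝ) : Prop :=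
  cov2 g11 g12 g22 z 0 0 p * cov2 g11 g12 g22 z 1 1 p
      - cov2 g11 g12 g22 z 0 1 p * cov2 g11 g12 g22 z 1 0 p
    = GaussK g11 g12 g22 p * gdet g11 g12 g22 p * (1 - gradSq g11 g12 g22 z p)

/-- A smooth Riemannian metric on Ω. -/
def IsMetricOn (g11 g12 g22 : ℝ × ℝ → ℝ) (Ω : Set (ℝ × ℝ)) : Prop :=
  ContDiffOn ℝ (⊤ : ℕ∞) g11 Ω ∧ ContDiffOn ℝ (⊤ : ℕ∞) g12 Ω ∧ ContDiffOn ℝ (⊤ : ℕ∞) g22 Ω ∧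
  ∀ p ∈ Ω, 0 < g11 p ∧ 0 < gdet g11 g12 g22 p

/-- The centers q_n = (1/n, 0). -/
def qpt (n : ℕ) : ℝ × ℝ := (1 / (n : ℝ), 0)

/-- Half-width of the square Xⁿ (whose width is 1/(2n(n+1))). -/
def halfw (n : ℕ) : ℝ := 1 / (4 * (n : ℝ) * ((n : ℝ) + 1))

/-- The open axis-parallel square Xⁿ centered at q_n of width 1/(2n(n+1)). -/
def sqX (n : ℕ) : Set (ℝ × ℝ) :=
  {p | |p.1 - 1 / (n : ℝ)| < halfw n ∧ |p.2| < halfw n}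

/-- The square X = (-1,1) × (-1,1). -/
def Xset : Set (ℝ × ℝ) := Ioo (-1 : ℝ) 1 ×ˢ Ioo (-1 : ℝ) 1

/-- φ is C^∞ on the closure of X, vanishes to infinite order on ∂X, and has a sign on X. -/
def PhiAdmissible (φ : ℝ × ℝ → ℝ) : Prop :=
  ContDiffOn ℝ (⊤ : ℕ∞) φ (closure Xset) ∧
  (∀ k : ℕ, ∀ p ∈ frontier Xset, iteratedFDerivWithin ℝ k φ (closure Xset) p = 0) ∧
  ((∀ p ∈ Xset, 0 < φ p) ∨ (∀ p ∈ Xset, φ p < 0))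

/-- K is obtained from φ and the sequence γ by the construction of the paper. -/
def Kconstr (φ : ℝ × ℝ → ℝ) (γ : ℕ → ℝ) (K : ℝ × ℝ → ℝ) : Prop :=
  (∀ n : ℕ, 1 ≤ n → ∀ q ∈ closure (sqX n),
      K q = γ n * φ ((4 * (n : ℝ) * ((n : ℝ) + 1)) • (q - qpt n))) ∧
  (∀ q : ℝ × ℝ, q ∉ ⋃ n ∈ {m : ℕ | 1 ≤ m}, sqX n → K q = 0)

/-- Right vertical side +v_n of ∂Xⁿ. -/
def vSideR (n : ℕ) : Set (ℝ × ℝ) :=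
  {p | p.1 = 1 / (n : ℝ) + halfw n ∧ |p.2| ≤ halfw n}

/-- Left vertical side -v_n of ∂Xⁿ. -/
def vSideL (n : ℕ) : Set (ℝ × ℝ) :=
  {p | p.1 = 1 / (n : ℝ) - halfw n ∧ |p.2| ≤ halfw n}

/-- Top horizontal side +h_n of ∂Xⁿ. -/
def hSideT (n : ℕ) : Set (ℝ × ℝ) :=
  {p | p.2 = halfw n ∧ |p.1 - 1 / (n : ℝ)| ≤ halfw n}

/-- Bottom horizontal side -h_n of ∂Xⁿ. -/
def hSideB (n : ℕ) : Set (ℝ × ℝ) :=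
  {p | p.2 = -halfw n ∧ |p.1 - 1 / (n : ℝ)| ≤ halfw n}

/-- At the point p there is a C³ change of coordinates Φ(x,y) = (x - p¹, s(x,y)) on a
neighborhood U ⊆ Ω of p, a C² function u and a positive continuous f on Φ(U), solving
∂_tt u + (K ∘ Φ⁻¹) ∂_ss u = (K ∘ Φ⁻¹) f on Φ(U). -/
def GoodChartAt (K : ℝ × ℝ → ℝ) (Ω : Set (ℝ × ℝ)) (p : ℝ × ℝ) : Prop :=
  ∃ (U : Set (ℝ × ℝ)) (s : ℝ × ℝ → ℝ) (Ψ : ℝ × ℝ → ℝ × ℝ) (u f : ℝ × ℝ → ℝ),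
    IsOpen U ∧ p ∈ U ∧ U ⊆ Ω ∧ ContDiffOn ℝ 3 s U ∧
    IsOpen ((fun q => (q.1 - p.1, s q)) '' U) ∧
    ContDiffOn ℝ 3 Ψ ((fun q => (q.1 - p.1, s q)) '' U) ∧
    (∀ q ∈ U, Ψ (q.1 - p.1, s q) = q) ∧
    (∀ w ∈ (fun q => (q.1 - p.1, s q)) '' U, ((Ψ w).1 - p.1, s (Ψ w)) = w) ∧
    ContDiffOn ℝ 2 u ((fun q => (q.1 - p.1, s q)) '' U) ∧
    ContinuousOn f ((fun q => (q.1 - p.1, s q)) '' U) ∧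
    (∀ w ∈ (fun q => (q.1 - p.1, s q)) '' U, 0 < f w) ∧
    (∀ w ∈ (fun q => (q.1 - p.1, s q)) '' U,
      pd 0 (pd 0 u) w + K (Ψ w) * pd 1 (pd 1 u) w = K (Ψ w) * f w)

lemma pd_add (i : Fin 2) {a b : ℝ × ℝ → ℝ} {p : ℝ × ℝ}
    (ha : DifferentiableAt ℝ a p) (hb : DifferentiableAt ℝ b p) :
    pd i (fun q => a q + b q) p = pd i a p + pd i b p := by
  change fderiv ℝ (a + b) p _ = _
  rw [(ha.hasFDerivAt.add hb.hasFDerivAt).fderiv]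
  rfl

lemma pd_sub (i : Fin 2) {a b : ℝ × ℝ → ℝ} {p : ℝ × ℝ}
    (ha : DifferentiableAt ℝ a p) (hb : DifferentiableAt ℝ b p) :
    pd i (fun q => a q - b q) p = pd i a p - pd i b p := by
  change fderiv ℝ (a - b) p _ = _
  rw [(ha.hasFDerivAt.sub hb.hasFDerivAt).fderiv]
  rfl

lemma pd_mul (i : Fin 2) {a b : ℝ × ℝ → ℝ} {p : ℝ × ℝ}
    (ha : DifferentiableAt ℝ a p) (hb : DifferentiableAt ℝ b p) :
    pd i (fun q => a q * b q) p = pd i a p * b p + a p * pd i b p := by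
  change fderiv ℝ (a * b) p _ = _
  rw [(ha.hasFDerivAt.mul hb.hasFDerivAt).fderiv]
  simp only [pd, add_apply, smul_apply, smul_eq_mul]
  ring

lemma pd_const (i : Fin 2) (c : ℝ) (p : ℝ × ℝ) : pd i (fun _ => c) p = 0 := by
  simp [pd]

lemma pd_congr_of_isOpen {Ω : Set (ℝ × ℝ)} (hΩ : IsOpen Ω) (i : Fin 2) {a b : ℝ × ℝ → ℝ}
    (h : ∀ q ∈ Ω, a q = b q) {p : ℝ × ℝ} (hp : p ∈ Ω) : pd i a p = pd i b p := by
  have : a =ᶠ[𝓝 p] b := Filter.eventually_of_mem (hΩ.mem_nhds hp) h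
  simp only [pd, this.fderiv_eq]

lemma contDiffOn_pd {Ω : Set (ℝ × ℝ)} (hΩ : IsOpen Ω) (i : Fin 2) {a : ℝ × ℝ → ℝ}
    {m n : WithTop ℕ∞} (h : ContDiffOn ℝ n a Ω) (hmn : m + 1 ≤ n) :
    ContDiffOn ℝ m (pd i a) Ω :=
  (h.fderiv_of_isOpen hΩ hmn).clm_apply contDiffOn_const

/-- Partial derivatives of a `C²` function commute. -/
lemma pd_comm {Ω : Set (ℝ × ℝ)} (hΩ : IsOpen Ω) {a : ℝ × ℝ → ℝ}
    (h : ContDiffOn ℝ 2 a Ω) {p : ℝ × ℝ} (hp : p ∈ Ω) :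
    pd 0 (pd 1 a) p = pd 1 (pd 0 a) p := by
  have hs : IsSymmSndFDerivAt ℝ a p :=
    (h.contDiffAt (hΩ.mem_nhds hp)).isSymmSndFDerivAt (by simp)
  have hd : DifferentiableAt ℝ (fderiv ℝ a) p :=
    ((h.fderiv_of_isOpen (m := 1) hΩ (by norm_num)).contDiffAt
      (hΩ.mem_nhds hp)).differentiableAt (by norm_num)
  have key : ∀ v w : ℝ × ℝ, fderiv ℝ (fun q => fderiv ℝ a q v) p w
      = fderiv ℝ (fderiv ℝ a) p w v := by
    intro v w
    rw [(hd.hasFDerivAt.clm_apply (hasFDerivAt_const v p)).fderiv]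
    simp
  exact (key (0, 1) (1, 0)).trans ((hs (1, 0) (0, 1)).trans (key (1, 0) (0, 1)).symm)

lemma chr_symm (g11 g12 g22 : ℝ × ℝ → ℝ) (l : Fin 2) :
    Chr g11 g12 g22 l 1 0 = Chr g11 g12 g22 l 0 1 := by
  funext p
  fin_cases l <;> simp [Chr, gmat, Fin.sum_univ_two]

/-- Metric compatibility of the Levi-Civita connection, in components. -/
lemma pd_metric {g11 g12 g22 : ℝ × ℝ → ℝ} {p : ℝ × ℝ} (hp : 0 < gdet g11 g12 g22 p) (k : Fin 2) :
    pd k g11 p = 2 * (Chr g11 g12 g22 0 0 k p * g11 p + Chr g11 g12 g22 1 0 k p * g12 p) ∧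
    pd k g12 p = Chr g11 g12 g22 0 0 k p * g12 p + Chr g11 g12 g22 1 0 k p * g22 p
      + (Chr g11 g12 g22 0 1 k p * g11 p + Chr g11 g12 g22 1 1 k p * g12 p) ∧
    pd k g22 p = 2 * (Chr g11 g12 g22 0 1 k p * g12 p + Chr g11 g12 g22 1 1 k p * g22 p) := by
  have hne := hp.ne'
  have hd : gdet g11 g12 g22 p = g11 p * g22 p - g12 p ^ 2 := rfl
  fin_cases k <;> refine ⟨?_, ?_, ?_⟩ <;>
    simp [Chr, gmat, ginv, Fin.sum_univ_two] <;> field_simp <;> rw [hd] <;> ring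

lemma contDiffOn_chr {Ω : Set (ℝ × ℝ)} (hΩ : IsOpen Ω) {g11 g12 g22 : ℝ × ℝ → ℝ}
    (hg : IsMetricOn g11 g12 g22 Ω) (l i j : Fin 2) :
    ContDiffOn ℝ (⊤ : ℕ∞) (Chr g11 g12 g22 l i j) Ω := by
  obtain ⟨h11, h12, h22, hpos⟩ := hg
  have hmat : ∀ i j, ContDiffOn ℝ (⊤ : ℕ∞) (gmat g11 g12 g22 i j) Ω := by
    intro i j
    fin_cases i <;> fin_cases j <;> simpa [gmat]
  have hdet : ContDiffOn ℝ (⊤ : ℕ∞) (gdet g11 g12 g22) Ω := (h11.mul h22).sub (h12.pow 2)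
  have hinv : ∀ i j, ContDiffOn ℝ (⊤ : ℕ∞) (ginv g11 g12 g22 i j) Ω := by
    intro i j
    have hne : ∀ p ∈ Ω, gdet g11 g12 g22 p ≠ 0 := fun p hp => (hpos p hp).2.ne'
    fin_cases i <;> fin_cases j
    · exact h22.div hdet hne
    · exact h12.neg.div hdet hne
    · exact h12.neg.div hdet hne
    · exact h11.div hdet hne
  refine contDiffOn_const.mul (ContDiffOn.sum fun m _ => (hinv l m).mul ?_)
  exact ((contDiffOn_pd hΩ i (hmat j m) (by simp)).add
    (contDiffOn_pd hΩ j (hmat i m) (by simp))).sub (contDiffOn_pd hΩ m (hmat i j) (by simp))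

/-- If the connection with coefficients `A = Γ₁₁`, `B = Γ₁₂`, `C = Γ₂₂` is compatible with the
metric `(E, F, G)`, its curvature is antisymmetric in the metric indices. -/
lemma curvature_antisymm {Ω : Set (ℝ × ℝ)} (hΩ : IsOpen Ω)
    {E F G A0 A1 B0 B1 C0 C1 : ℝ × ℝ → ℝ}
    (hE : ContDiffOn ℝ 2 E Ω) (hF : ContDiffOn ℝ 2 F Ω) (hG : ContDiffOn ℝ 2 G Ω)
    (hE0 : ∀ q ∈ Ω, pd 0 E q = 2 * (A0 q * E q + A1 q * F q))
    (hE1 : ∀ q ∈ Ω, pd 1 E q = 2 * (B0 q * E q + B1 q * F q))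
    (hF0 : ∀ q ∈ Ω, pd 0 F q = A0 q * F q + A1 q * G q + (B0 q * E q + B1 q * F q))
    (hF1 : ∀ q ∈ Ω, pd 1 F q = B0 q * F q + B1 q * G q + (C0 q * E q + C1 q * F q))
    (hG0 : ∀ q ∈ Ω, pd 0 G q = 2 * (B0 q * F q + B1 q * G q))
    (hG1 : ∀ q ∈ Ω, pd 1 G q = 2 * (C0 q * F q + C1 q * G q))
    {p : ℝ × ℝ} (hp : p ∈ Ω)
    (dA0 : DifferentiableAt ℝ A0 p) (dA1 : DifferentiableAt ℝ A1 p)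
    (dB0 : DifferentiableAt ℝ B0 p) (dB1 : DifferentiableAt ℝ B1 p)
    (dC0 : DifferentiableAt ℝ C0 p) (dC1 : DifferentiableAt ℝ C1 p)
    {R0 R1 S0 S1 : ℝ}
    (hR0 : R0 = pd 0 C0 p - pd 1 B0 p
      + (C0 p * A0 p + C1 p * B0 p - B0 p * B0 p - B1 p * C0 p))
    (hR1 : R1 = pd 0 C1 p - pd 1 B1 p
      + (C0 p * A1 p + C1 p * B1 p - B0 p * B1 p - B1 p * C1 p))
    (hS0 : S0 = pd 1 A0 p - pd 0 B0 p
      + (A0 p * B0 p + A1 p * C0 p - B0 p * A0 p - B1 p * B0 p))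
    (hS1 : S1 = pd 1 A1 p - pd 0 B1 p
      + (A0 p * B1 p + A1 p * C1 p - B0 p * A1 p - B1 p * B1 p)) :
    F p * R0 + G p * R1 = 0 ∧ E p * S0 + F p * S1 = 0 ∧
      F p * S0 + G p * S1 = E p * R0 + F p * R1 := by
  have dE : DifferentiableAt ℝ E p :=
    (hE.contDiffAt (hΩ.mem_nhds hp)).differentiableAt (by norm_num)
  have dF : DifferentiableAt ℝ F p :=
    (hF.contDiffAt (hΩ.mem_nhds hp)).differentiableAt (by norm_num)
  have dG : DifferentiableAt ℝ G p :=
    (hG.contDiffAt (hΩ.mem_nhds hp)).differentiableAt (by norm_num)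
  have cE := pd_comm hΩ hE hp
  have cF := pd_comm hΩ hF hp
  have cG := pd_comm hΩ hG hp
  rw [pd_congr_of_isOpen hΩ 0 hE1 hp, pd_congr_of_isOpen hΩ 1 hE0 hp] at cE
  rw [pd_congr_of_isOpen hΩ 0 hF1 hp, pd_congr_of_isOpen hΩ 1 hF0 hp] at cF
  rw [pd_congr_of_isOpen hΩ 0 hG1 hp, pd_congr_of_isOpen hΩ 1 hG0 hp] at cG
  simp (disch := fun_prop) only [pd_add, pd_mul, pd_const, hE0 p hp, hE1 p hp, hF0 p hp, hF1 p hp,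
    hG0 p hp, hG1 p hp] at cE cF cG
  subst hR0 hR1 hS0 hS1
  refine ⟨?_, ?_, ?_⟩
  · linear_combination cG / 2
  · linear_combination -cE / 2
  · linear_combination -cF

/-- The divergence of the cofactor Hessian field, for abstract connection coefficients with
curvature `K`; `c00`, `c01`, `c11` are the second covariant derivatives of `z` and `w` is the
inverse volume density. -/
lemma divergence_cofactor_field {Ω : Set (ℝ × ℝ)} (hΩ : IsOpen Ω)
    {A0 A1 B0 B1 C0 C1 z w c00 c01 c11 : ℝ × ℝ → ℝ}
    (hz : ContDiffOn ℝ 3 z Ω)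
    {p : ℝ × ℝ} (hp : p ∈ Ω)
    (dA0 : DifferentiableAt ℝ A0 p) (dA1 : DifferentiableAt ℝ A1 p)
    (dB0 : DifferentiableAt ℝ B0 p) (dB1 : DifferentiableAt ℝ B1 p)
    (dC0 : DifferentiableAt ℝ C0 p) (dC1 : DifferentiableAt ℝ C1 p)
    (dw : DifferentiableAt ℝ w p)
    (hw0 : pd 0 w p = -(A0 p + B1 p) * w p) (hw1 : pd 1 w p = -(B0 p + C1 p) * w p)
    (h00 : c00 = fun q => pd 0 (pd 0 z) q - (A0 q * pd 0 z q + A1 q * pd 1 z q))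
    (h01 : c01 = fun q => pd 0 (pd 1 z) q - (B0 q * pd 0 z q + B1 q * pd 1 z q))
    (h11 : c11 = fun q => pd 1 (pd 1 z) q - (C0 q * pd 0 z q + C1 q * pd 1 z q))
    {E F G K : ℝ}
    (hR0 : pd 0 C0 p - pd 1 B0 p
      + (C0 p * A0 p + C1 p * B0 p - B0 p * B0 p - B1 p * C0 p) = K * G)
    (hR1 : pd 0 C1 p - pd 1 B1 p
      + (C0 p * A1 p + C1 p * B1 p - B0 p * B1 p - B1 p * C1 p) = -(K * F))
    (hS0 : pd 1 A0 p - pd 0 B0 p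
      + (A0 p * B0 p + A1 p * C0 p - B0 p * A0 p - B1 p * B0 p) = -(K * F))
    (hS1 : pd 1 A1 p - pd 0 B1 p
      + (A0 p * B1 p + A1 p * C1 p - B0 p * A1 p - B1 p * B1 p) = K * E) :
    pd 0 (fun q => w q * (pd 0 z q * c11 q - pd 1 z q * c01 q)) p
      + pd 1 (fun q => w q * (pd 1 z q * c00 q - pd 0 z q * c01 q)) p
    = w p * (2 * (c00 p * c11 p - c01 p * c01 p)
      - K * (G * pd 0 z p ^ 2 - 2 * F * pd 0 z p * pd 1 z p + E * pd 1 z p ^ 2)) := by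
  have hpd : ∀ i, ContDiffOn ℝ 2 (pd i z) Ω := fun i => contDiffOn_pd hΩ i hz (by norm_num)
  have d1 : ∀ i, DifferentiableAt ℝ (pd i z) p := fun i =>
    ((hpd i).contDiffAt (hΩ.mem_nhds hp)).differentiableAt (by norm_num)
  have d2 : ∀ i j, DifferentiableAt ℝ (pd i (pd j z)) p := fun i j =>
    ((contDiffOn_pd (m := 1) hΩ i (hpd j) (by norm_num)).contDiffAt
      (hΩ.mem_nhds hp)).differentiableAt (by norm_num)
  have comm : ∀ q ∈ Ω, pd 0 (pd 1 z) q = pd 1 (pd 0 z) q :=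
    fun q hq => pd_comm hΩ (hz.of_le (by norm_num)) hq
  have t0 : pd 0 (pd 0 (pd 1 z)) p = pd 1 (pd 0 (pd 0 z)) p := by
    rw [pd_congr_of_isOpen hΩ 0 comm hp, pd_comm hΩ (hpd 0) hp]
  have t1 : pd 0 (pd 1 (pd 1 z)) p = pd 1 (pd 0 (pd 1 z)) p := pd_comm hΩ (hpd 1) hp
  have s := comm p hp
  have d10 := d1 0
  have d11 := d1 1
  have d200 := d2 0 0
  have d201 := d2 0 1
  have d211 := d2 1 1
  subst h00 h01 h11
  simp (disch := fun_prop) only [pd_add, pd_sub, pd_mul, hw0, hw1]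
  rw [t0, t1, ← s]
  generalize pd 0 (pd 0 z) p = z00 at *
  generalize pd 0 (pd 1 z) p = z01 at *
  generalize pd 1 (pd 1 z) p = z11 at *
  generalize pd 0 z p = z0 at *
  generalize pd 1 z p = z1 at *
  linear_combination (-w p * z0 * z0) * hR0 + (-w p * z0 * z1) * hR1
    + (-w p * z1 * z0) * hS0 + (-w p * z1 * z1) * hS1

lemma pd_inv_sqrt (k : Fin 2) {D : ℝ × ℝ → ℝ} {Ω : Set (ℝ × ℝ)} (hΩ : IsOpen Ω)
    (hD : ∀ q ∈ Ω, 0 < D q) {p : ℝ × ℝ} (hp : p ∈ Ω) (dD : DifferentiableAt ℝ D p) {T : ℝ}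
    (hT : pd k D p = 2 * T * D p) :
    pd k (fun q => (√(D q))⁻¹) p = -T * (√(D p))⁻¹ := by
  have hpos := hD p hp
  have dw : DifferentiableAt ℝ (fun q => (√(D q))⁻¹) p :=
    (dD.sqrt hpos.ne').inv (Real.sqrt_pos.2 hpos).ne'
  have h1 : ∀ q ∈ Ω, (√(D q))⁻¹ * (√(D q))⁻¹ * D q = 1 := by
    intro q hq
    have := hD q hq
    rw [← mul_inv, Real.mul_self_sqrt this.le, inv_mul_cancel₀ this.ne']
  have h2 := pd_congr_of_isOpen hΩ k h1 hp
  simp (disch := fun_prop) only [pd_mul, pd_const, hT] at h2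
  have hw : (√(D p))⁻¹ * D p ≠ 0 :=
    mul_ne_zero (inv_ne_zero (Real.sqrt_pos.2 hpos).ne') hpos.ne'
  refine mul_left_cancel₀ hw ?_
  linear_combination h2 / 2

/-- Contracting with the metric: a vector with covariant components `(K D, 0)`. -/
lemma eq_of_lower_eq {E F G D K R0 R1 : ℝ} (hD : D = E * G - F ^ 2) (hpos : 0 < D)
    (h0 : E * R0 + F * R1 = K * D) (h1 : F * R0 + G * R1 = 0) : R0 = K * G ∧ R1 = -(K * F) := by
  constructor <;> refine mul_left_cancel₀ hpos.ne' ?_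
  · linear_combination G * h0 - F * h1 + R0 * hD
  · linear_combination E * h1 - F * h0 + R1 * hD

/-- Pointwise form of the identity: for a solution of Darboux's equation, the divergence of the
cofactor Hessian field is `K (2 - 3 |∇z|²) √(det g)`. -/
lemma divergence_eq_of_darboux {Ω : Set (ℝ × ℝ)} (hΩ : IsOpen Ω)
    {g11 g12 g22 z : ℝ × ℝ → ℝ} (hg : IsMetricOn g11 g12 g22 Ω) (hz : ContDiffOn ℝ 3 z Ω)
    {p : ℝ × ℝ} (hp : p ∈ Ω) (hD : DarbouxEq g11 g12 g22 z p) :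
    pd 0 (fun q => (√(gdet g11 g12 g22 q))⁻¹ *
        (pd 0 z q * cov2 g11 g12 g22 z 1 1 q - pd 1 z q * cov2 g11 g12 g22 z 0 1 q)) p
      + pd 1 (fun q => (√(gdet g11 g12 g22 q))⁻¹ *
        (pd 1 z q * cov2 g11 g12 g22 z 0 0 q - pd 0 z q * cov2 g11 g12 g22 z 0 1 q)) p
    = GaussK g11 g12 g22 p * (2 - 3 * gradSq g11 g12 g22 z p) * √(gdet g11 g12 g22 p) := by
  have dΓ : ∀ l i j, DifferentiableAt ℝ (Chr g11 g12 g22 l i j) p := fun l i j =>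
    ((contDiffOn_chr hΩ hg l i j).contDiffAt (hΩ.mem_nhds hp)).differentiableAt (by simp)
  obtain ⟨h11, h12, h22, hpos⟩ := hg
  have le2 : (2 : WithTop ℕ∞) ≤ ((⊤ : ℕ∞) : WithTop ℕ∞) :=
    WithTop.coe_le_coe.2 (le_top : (2 : ℕ∞) ≤ ⊤)
  have dg : ∀ {f : ℝ × ℝ → ℝ}, ContDiffOn ℝ (⊤ : ℕ∞) f Ω → DifferentiableAt ℝ f p := fun h =>
    (h.contDiffAt (hΩ.mem_nhds hp)).differentiableAt (by simp)
  have dE := dg h11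
  have dF := dg h12
  have dG := dg h22
  have hdet : gdet g11 g12 g22 = fun q => g11 q * g22 q - g12 q * g12 q := by
    funext q; simp only [gdet]; ring
  have hDpos := (hpos p hp).2
  have dD : DifferentiableAt ℝ (gdet g11 g12 g22) p := by rw [hdet]; fun_prop
  have met := fun q (hq : q ∈ Ω) (k : Fin 2) => pd_metric (hpos q hq).2 k
  have hΓ := chr_symm g11 g12 g22
  have hT : ∀ k, pd k (gdet g11 g12 g22) p
      = 2 * (Chr g11 g12 g22 0 0 k p + Chr g11 g12 g22 1 1 k p) * gdet g11 g12 g22 p := by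
    intro k
    obtain ⟨m1, m2, m3⟩ := met p hp k
    rw [hdet]
    simp (disch := fun_prop) only [pd_sub, pd_mul, m1, m2, m3]
    ring
  have hw := fun k => pd_inv_sqrt k hΩ (fun q hq => (hpos q hq).2) hp dD (hT k)
  have hw0 := hw 0
  rw [hΓ] at hw0
  have dw : DifferentiableAt ℝ (fun q => (√(gdet g11 g12 g22 q))⁻¹) p :=
    (dD.sqrt hDpos.ne').inv (Real.sqrt_pos.2 hDpos).ne'
  have hK : ∀ i, pd 0 (Chr g11 g12 g22 i 1 1) p - pd 1 (Chr g11 g12 g22 i 0 1) p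
      + ∑ j : Fin 2, (Chr g11 g12 g22 j 1 1 p * Chr g11 g12 g22 i j 0 p
          - Chr g11 g12 g22 j 0 1 p * Chr g11 g12 g22 i j 1 p)
      = pd 0 (Chr g11 g12 g22 i 1 1) p - pd 1 (Chr g11 g12 g22 i 0 1) p
      + (Chr g11 g12 g22 0 1 1 p * Chr g11 g12 g22 i 0 0 p
        + Chr g11 g12 g22 1 1 1 p * Chr g11 g12 g22 i 0 1 p
        - Chr g11 g12 g22 0 0 1 p * Chr g11 g12 g22 i 0 1 p
        - Chr g11 g12 g22 1 0 1 p * Chr g11 g12 g22 i 1 1 p) := by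
    intro i
    rw [Fin.sum_univ_two, hΓ]
    ring
  have hK2 := (div_eq_iff hDpos.ne').1 ((one_div_mul_eq_div _ _).symm.trans
    (rfl : _ = GaussK g11 g12 g22 p))
  rw [Fin.sum_univ_two, hK, hK] at hK2
  simp only [gmat, if_true, one_ne_zero, if_false] at hK2
  obtain ⟨e1, e2, e3⟩ := curvature_antisymm hΩ (h11.of_le le2) (h12.of_le le2) (h22.of_le le2)
    (fun q hq => (met q hq 0).1) (fun q hq => (met q hq 1).1)
    (fun q hq => by rw [(met q hq 0).2.1, hΓ, hΓ]) (fun q hq => (met q hq 1).2.1)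
    (fun q hq => by rw [(met q hq 0).2.2, hΓ, hΓ]) (fun q hq => (met q hq 1).2.2) hp
    (dΓ _ _ _) (dΓ _ _ _) (dΓ _ _ _) (dΓ _ _ _) (dΓ _ _ _) (dΓ _ _ _) rfl rfl rfl rfl
  rw [hK2] at e3
  obtain ⟨r0, r1⟩ := eq_of_lower_eq rfl hDpos hK2 e1
  obtain ⟨s1, s0⟩ := eq_of_lower_eq (E := g22 p) (F := g12 p) (G := g11 p)
    (D := gdet g11 g12 g22 p) (by simp only [gdet]; ring) hDpos
    ((add_comm _ _).trans e3) ((add_comm _ _).trans e2)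
  have hc : ∀ i j, cov2 g11 g12 g22 z i j = fun q => pd i (pd j z) q
      - (Chr g11 g12 g22 0 i j q * pd 0 z q + Chr g11 g12 g22 1 i j q * pd 1 z q) := by
    intro i j; funext q; simp only [cov2, Fin.sum_univ_two]
  rw [divergence_cofactor_field hΩ hz hp (dΓ _ _ _) (dΓ _ _ _) (dΓ _ _ _) (dΓ _ _ _) (dΓ _ _ _)
    (dΓ _ _ _) dw hw0 (hw 1) (hc 0 0) (hc 0 1) (hc 1 1) r0 r1 s0 s1]
  have hsymm : cov2 g11 g12 g22 z 1 0 p = cov2 g11 g12 g22 z 0 1 p := by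
    simp only [hc, hΓ, pd_comm hΩ (hz.of_le (by norm_num)) hp]
  simp only [DarbouxEq, hsymm] at hD
  have hgrad : g22 p * pd 0 z p ^ 2 - 2 * g12 p * pd 0 z p * pd 1 z p + g11 p * pd 1 z p ^ 2
      = gdet g11 g12 g22 p * gradSq g11 g12 g22 z p := by
    have := hDpos.ne'
    simp only [gradSq, ginv, Fin.sum_univ_two, if_true, one_ne_zero, if_false]
    field_simp
    ring
  have hsq : (√(gdet g11 g12 g22 p))⁻¹ * gdet g11 g12 g22 p = √(gdet g11 g12 g22 p) := by
    rw [inv_mul_eq_div, Real.div_sqrt]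
  rw [hD, hgrad]
  linear_combination
    (GaussK g11 g12 g22 p * (2 - 3 * gradSq g11 g12 g22 z p)) * hsq

theorem darboux_divergence_identity_on_rectangle
    (Ω : Set (ℝ × ℝ)) (hΩ : IsOpen Ω)
    (g11 g12 g22 : ℝ × ℝ → ℝ) (hg : IsMetricOn g11 g12 g22 Ω)
    (z : ℝ × ℝ → ℝ) (hz : ContDiffOn ℝ 3 z Ω)
    (hD : ∀ p ∈ Ω, DarbouxEq g11 g12 g22 z p)
    (a₁ a₂ b₁ b₂ : ℝ) (ha : a₁ ≤ a₂) (hb : b₁ ≤ b₂)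
    (hR : Icc a₁ a₂ ×ˢ Icc b₁ b₂ ⊆ Ω)
    (h1 h2 : ℝ × ℝ → ℝ)
    (hh1 : ∀ p : ℝ × ℝ, h1 p = (Real.sqrt (gdet g11 g12 g22 p))⁻¹ *
      (pd 0 z p * cov2 g11 g12 g22 z 1 1 p - pd 1 z p * cov2 g11 g12 g22 z 0 1 p))
    (hh2 : ∀ p : ℝ × ℝ, h2 p = (Real.sqrt (gdet g11 g12 g22 p))⁻¹ *
      (pd 1 z p * cov2 g11 g12 g22 z 0 0 p - pd 0 z p * cov2 g11 g12 g22 z 0 1 p)) :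
    (∫ x in a₁..a₂, ∫ y in b₁..b₂,
        GaussK g11 g12 g22 (x, y) * (2 - 3 * gradSq g11 g12 g22 z (x, y))
          * Real.sqrt (gdet g11 g12 g22 (x, y)))
      = (∫ y in b₁..b₂, (h1 (a₂, y) - h1 (a₁, y)))
        + ∫ x in a₁..a₂, (h2 (x, b₂) - h2 (x, b₁)) := by
  have hdet : ContDiffOn ℝ 1 (fun q => (√(gdet g11 g12 g22 q))⁻¹) Ω := by
    have h : ContDiffOn ℝ (⊤ : ℕ∞) (gdet g11 g12 g22) Ω :=
      (hg.1.mul hg.2.2.1).sub (hg.2.1.pow 2)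
    have hpos : ∀ q ∈ Ω, 0 < gdet g11 g12 g22 q := fun q hq => (hg.2.2.2 q hq).2
    exact ((h.of_le (by exact_mod_cast le_top)).sqrt fun q hq => (hpos q hq).ne').inv
      fun q hq => (Real.sqrt_pos.2 (hpos q hq)).ne'
  have hpd : ∀ i, ContDiffOn ℝ 2 (pd i z) Ω := fun i => contDiffOn_pd hΩ i hz (by norm_num)
  have hpd1 : ∀ i, ContDiffOn ℝ 1 (pd i z) Ω := fun i => (hpd i).of_le (by norm_num)
  have hcov : ∀ i j, ContDiffOn ℝ 1 (cov2 g11 g12 g22 z i j) Ω := fun i j =>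
    (contDiffOn_pd hΩ i (hpd j) (by norm_num)).sub (ContDiffOn.sum fun l _ =>
      ((contDiffOn_chr hΩ hg l i j).of_le (by exact_mod_cast le_top)).mul (hpd1 l))
  have ch1 : ContDiffOn ℝ 1 h1 Ω := by
    rw [funext hh1]
    exact hdet.mul (((hpd1 0).mul (hcov 1 1)).sub ((hpd1 1).mul (hcov 0 1)))
  have ch2 : ContDiffOn ℝ 1 h2 Ω := by
    rw [funext hh2]
    exact hdet.mul (((hpd1 1).mul (hcov 0 0)).sub ((hpd1 0).mul (hcov 0 1)))
  have hdiv : ∀ p ∈ Ω, fderiv ℝ h1 p (1, 0) + fderiv ℝ h2 p (0, 1)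
      = GaussK g11 g12 g22 p * (2 - 3 * gradSq g11 g12 g22 z p) * √(gdet g11 g12 g22 p) := by
    intro p hp
    rw [← divergence_eq_of_darboux hΩ hg hz hp (hD p hp), ← funext hh1, ← funext hh2]
    simp [pd]
  have hR' : uIcc a₁ a₂ ×ˢ uIcc b₁ b₂ ⊆ Ω := by rwa [uIcc_of_le ha, uIcc_of_le hb]
  have hint : (∫ x in a₁..a₂, ∫ y in b₁..b₂,
        GaussK g11 g12 g22 (x, y) * (2 - 3 * gradSq g11 g12 g22 z (x, y))
          * Real.sqrt (gdet g11 g12 g22 (x, y)))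
      = ∫ x in a₁..a₂, ∫ y in b₁..b₂, fderiv ℝ h1 (x, y) (1, 0) + fderiv ℝ h2 (x, y) (0, 1) := by
    refine intervalIntegral.integral_congr fun x hx => ?_
    refine intervalIntegral.integral_congr fun y hy => ?_
    exact (hdiv (x, y) (hR' ⟨hx, hy⟩)).symm
  have hfd : ∀ {h : ℝ × ℝ → ℝ}, ContDiffOn ℝ 1 h Ω →
      ∀ q ∈ Ioo (min a₁ a₂) (max a₁ a₂) ×ˢ Ioo (min b₁ b₂) (max b₁ b₂) \ ∅,
        HasFDerivAt h (fderiv ℝ h q) q := fun ch q hq =>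
    ((ch.contDiffAt (hΩ.mem_nhds (hR' ⟨Ioo_subset_Icc_self hq.1.1,
      Ioo_subset_Icc_self hq.1.2⟩))).differentiableAt (by norm_num)).hasFDerivAt
  have hcd : ∀ {h : ℝ × ℝ → ℝ}, ContDiffOn ℝ 1 h Ω → ∀ v,
      ContinuousOn (fun q => fderiv ℝ h q v) (uIcc a₁ a₂ ×ˢ uIcc b₁ b₂) := fun ch v =>
    ((ch.continuousOn_fderiv_of_isOpen hΩ le_rfl).mono hR').clm_apply continuousOn_const
  rw [hint, MeasureTheory.integral2_divergence_prod_of_hasFDerivAt_off_countable h1 h2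
    (fderiv ℝ h1) (fderiv ℝ h2) a₁ b₁ a₂ b₂ ∅ countable_empty (ch1.continuousOn.mono hR')
    (ch2.continuousOn.mono hR') (hfd ch1) (hfd ch2)
    (((hcd ch1 _).add (hcd ch2 _)).integrableOn_compact (isCompact_uIcc.prod isCompact_uIcc))]
  have hv : ∀ x ∈ uIcc a₁ a₂,
      IntervalIntegrable (fun y => h1 (x, y)) MeasureTheory.volume b₁ b₂ := fun x hx =>
    (ch1.continuousOn.comp (by fun_prop) fun y hy => hR' ⟨hx, hy⟩).intervalIntegrable
  have hh : ∀ y ∈ uIcc b₁ b₂,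
      IntervalIntegrable (fun x => h2 (x, y)) MeasureTheory.volume a₁ a₂ := fun y hy =>
    (ch2.continuousOn.comp (by fun_prop) fun x hx => hR' ⟨hx, hy⟩).intervalIntegrable
  rw [intervalIntegral.integral_sub (hv _ right_mem_uIcc) (hv _ left_mem_uIcc),
    intervalIntegral.integral_sub (hh _ right_mem_uIcc) (hh _ left_mem_uIcc)]
  ring

end
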